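/- arXiv:1408.0589 — 2 statements merged into one kernel-verified Lean document; each statement's English description precedes it below -/
import Mathlib

section
/- Let X be a quasiparabolic W-set that is bounded below, let β be a bar operator on ℳ, and let 𝒞 ⊆ A be a subset such that the only element f ∈ 𝒞 with f̄ = f is f = 0. If m ∈ ℳ satisfies β(m) = m and every coefficient of m with respect to the standard basis (M_x) lies in 𝒞, then m = 0. The analogous statement holds for a bar operator on 𝒩 and the basis (N_x). In particular, this applies with 𝒞 = v⁻¹·ℤ[v⁻¹]. -/
noncomputable section

open LaurentPolynomial

/-- The Laurent polynomial ring `A = ℤ[v,v⁻¹]`. -/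
abbrev A : Type := LaurentPolynomial ℤ

/-- The element `v`. -/
def v : A := T 1

/-- The element `v⁻¹`. -/
def vinv : A := T (-1)

/-- The bar involution of `A`, sending `v ↦ v⁻¹`. -/
def Abar : A → A := LaurentPolynomial.invert

/-- The set `v⁻¹·ℤ[v⁻¹] ⊆ A`. -/
def negPart : Set A := { f | ∃ p : Polynomial ℤ, f = Polynomial.aeval vinv (Polynomial.X * p) }

variable {B W : Type*} [Group W] {M : CoxeterMatrix B} {X : Type*}

/-- `σ : W → X → X` is a group action of `W` on `X`. -/
def IsActionOf (σ : W → X → X) : Prop :=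
  (∀ x, σ 1 x = x) ∧ ∀ w w' x, σ (w * w') x = σ w (σ w' x)

/-- `(X, ht)` is a scaled `W`-set (relative to the action `σ`). -/
def IsScaled (cs : CoxeterSystem M W) (σ : W → X → X) (ht : X → ℚ) : Prop :=
  ∀ (i : B) (x : X), ht (σ (cs.simple i) x) - ht x ∈ ({-1, 0, 1} : Set ℚ)

/-- `(X, ht)` is a quasiparabolic `W`-set. -/
def IsQP (cs : CoxeterSystem M W) (σ : W → X → X) (ht : X → ℚ) : Prop :=
  IsScaled cs σ ht ∧
  (∀ r : W, cs.IsReflection r → ∀ x : X, ht (σ r x) = ht x → σ r x = x) ∧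
  (∀ r : W, cs.IsReflection r → ∀ (x : X) (i : B),
      ht x < ht (σ r x) → ht (σ (cs.simple i) (σ r x)) < ht (σ (cs.simple i) x) →
      σ r x = σ (cs.simple i) x)

/-- `x` is a `W`-minimal element of `X`. -/
def WMin (cs : CoxeterSystem M W) (σ : W → X → X) (ht : X → ℚ) (x : X) : Prop :=
  ∀ i : B, ht x ≤ ht (σ (cs.simple i) x)

/-- Every `W`-orbit of `X` contains a `W`-minimal element. -/
def BoundedBelow (cs : CoxeterSystem M W) (σ : W → X → X) (ht : X → ℚ) : Prop :=
  ∀ x : X, ∃ w : W, WMin cs σ ht (σ w x)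

/-- The strict Bruhat order on a quasiparabolic set. -/
def bruhatLT (cs : CoxeterSystem M W) (σ : W → X → X) (ht : X → ℚ) : X → X → Prop :=
  Relation.TransGen fun a b => ∃ r : W, cs.IsReflection r ∧ b = σ r a ∧ ht a < ht b

/-- The standard basis element `M_x` (also `N_x`) of the free `A`-module on `X`. -/
def Mstd (x : X) : X →₀ A := Finsupp.single x 1

/-- The operator `T_s` on the module `ℳ`. -/
def Ts (cs : CoxeterSystem M W) (σ : W → X → X) (ht : X → ℚ) (i : B) :
    (X →₀ A) →ₗ[A] (X →₀ A) :=
  Finsupp.lift (X →₀ A) A X fun x =>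
    if ht x < ht (σ (cs.simple i) x) then Mstd (σ (cs.simple i) x)
    else if ht (σ (cs.simple i) x) < ht x then Mstd (σ (cs.simple i) x) + (v - vinv) • Mstd x
    else v • Mstd x

/-- The operator `U_s` on the module `𝒩`. -/
def Us (cs : CoxeterSystem M W) (σ : W → X → X) (ht : X → ℚ) (i : B) :
    (X →₀ A) →ₗ[A] (X →₀ A) :=
  Finsupp.lift (X →₀ A) A X fun x =>
    if ht x < ht (σ (cs.simple i) x) then Mstd (σ (cs.simple i) x)
    else if ht (σ (cs.simple i) x) < ht x then Mstd (σ (cs.simple i) x) + (v - vinv) • Mstd x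
    else (-vinv) • Mstd x

/-- A bar operator on the module `ℳ`. -/
def IsBarOpM (cs : CoxeterSystem M W) (σ : W → X → X) (ht : X → ℚ)
    (β : (X →₀ A) → (X →₀ A)) : Prop :=
  (∀ m m', β (m + m') = β m + β m') ∧
  (∀ (f : A) (m : X →₀ A), β (f • m) = Abar f • β m) ∧
  (∀ (i : B) (m : X →₀ A), β (Ts cs σ ht i m) = Ts cs σ ht i (β m) + (vinv - v) • β m) ∧
  (∀ x : X, WMin cs σ ht x → β (Mstd x) = Mstd x)

/-- A bar operator on the module `𝒩`. -/
def IsBarOpN (cs : CoxeterSystem M W) (σ : W → X → X) (ht : X → ℚ)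
    (β : (X →₀ A) → (X →₀ A)) : Prop :=
  (∀ n n', β (n + n') = β n + β n') ∧
  (∀ (f : A) (n : X →₀ A), β (f • n) = Abar f • β n) ∧
  (∀ (i : B) (n : X →₀ A), β (Us cs σ ht i n) = Us cs σ ht i (β n) + (vinv - v) • β n) ∧
  (∀ x : X, WMin cs σ ht x → β (Mstd x) = Mstd x)


/-- One upward step along a reflection; `bruhatLT` is its transitive closure. -/
def bruhatStep (cs : CoxeterSystem M W) (σ : W → X → X) (ht : X → ℚ) (a b : X) : Prop :=
  ∃ r : W, cs.IsReflection r ∧ b = σ r a ∧ ht a < ht b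

theorem IsActionOf.simple_simple {σ : W → X → X} (hact : IsActionOf σ)
    (cs : CoxeterSystem M W) (i : B) (x : X) :
    σ (cs.simple i) (σ (cs.simple i) x) = x := by
  rw [← hact.2, cs.simple_mul_simple_self, hact.1]

theorem IsScaled.height_simple_le {cs : CoxeterSystem M W} {σ : W → X → X} {ht : X → ℚ}
    (h : IsScaled cs σ ht) (i : B) (x : X) : ht (σ (cs.simple i) x) ≤ ht x + 1 := by
  have hmem := h i x
  simp only [Set.mem_insert_iff, Set.mem_singleton_iff] at hmem
  rcases hmem with h | h | h <;> linarith

theorem IsScaled.height_simple_of_lt {cs : CoxeterSystem M W} {σ : W → X → X} {ht : X → ℚ}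
    (h : IsScaled cs σ ht) {i : B} {x : X} (hlt : ht (σ (cs.simple i) x) < ht x) :
    ht (σ (cs.simple i) x) = ht x - 1 := by
  have hmem := h i x
  simp only [Set.mem_insert_iff, Set.mem_singleton_iff] at hmem
  rcases hmem with h | h | h <;> linarith

/-- The lifting property: a simple reflection either reverses a Bruhat step or weakly
preserves it. -/
theorem bruhatStep.lift {cs : CoxeterSystem M W} {σ : W → X → X} {ht : X → ℚ}
    (hact : IsActionOf σ) (hqp : IsQP cs σ ht) {a b : X} (hab : bruhatStep cs σ ht a b)
    (i : B) :
    b = σ (cs.simple i) a ∨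
      Relation.ReflTransGen (bruhatStep cs σ ht) (σ (cs.simple i) a) (σ (cs.simple i) b) := by
  obtain ⟨r, hr, rfl, hlt⟩ := hab
  have hconj : cs.IsReflection (cs.simple i * r * cs.simple i) := by
    simpa using hr.conj (cs.simple i)
  have hσ : σ (cs.simple i) (σ r a) =
      σ (cs.simple i * r * cs.simple i) (σ (cs.simple i) a) := by
    rw [hact.2, hact.2, hact.simple_simple]
  rcases lt_trichotomy (ht (σ (cs.simple i) (σ r a))) (ht (σ (cs.simple i) a)) with h | h | h
  · exact Or.inl (hqp.2.2 r hr a i hlt h)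
  · right
    rw [hσ] at h ⊢
    rw [hqp.2.1 _ hconj _ h]
  · exact Or.inr (.single ⟨_, hconj, hσ, h⟩)

theorem WMin.bruhat_le_simple {cs : CoxeterSystem M W} {σ : W → X → X} {ht : X → ℚ}
    (hact : IsActionOf σ) (hqp : IsQP cs σ ht) {x₀ y : X} (hx₀ : WMin cs σ ht x₀)
    (hy : Relation.ReflTransGen (bruhatStep cs σ ht) x₀ y) (i : B) :
    Relation.ReflTransGen (bruhatStep cs σ ht) x₀ (σ (cs.simple i) y) := by
  induction hy with
  | refl =>
    rcases (hx₀ i).lt_or_eq with h | h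
    · exact .single ⟨_, cs.isReflection_simple i, rfl, h⟩
    · rw [hqp.2.1 _ (cs.isReflection_simple i) _ h.symm]
  | tail hb hstep ih =>
    rcases hstep.lift hact hqp i with h | h
    · rwa [h, hact.simple_simple]
    · exact ih.trans h

/-- A `W`-minimal element has the least height in its orbit. -/
theorem WMin.height_le {cs : CoxeterSystem M W} {σ : W → X → X} {ht : X → ℚ}
    (hact : IsActionOf σ) (hqp : IsQP cs σ ht) {x₀ : X} (hx₀ : WMin cs σ ht x₀) (w : W) :
    ht x₀ ≤ ht (σ w x₀) := by
  have h : Relation.ReflTransGen (bruhatStep cs σ ht) x₀ (σ w x₀) := by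
    induction w using cs.simple_induction_left with
    | one => rw [hact.1]
    | mul_simple_left w i ih =>
      rw [hact.2]
      exact hx₀.bruhat_le_simple hact hqp ih i
  generalize σ w x₀ = y at h
  induction h with
  | refl => exact le_rfl
  | tail _ hstep ih =>
    obtain ⟨_, _, _, hlt⟩ := hstep
    exact ih.trans hlt.le

/-- Every element of a bounded below quasiparabolic set is obtained from `W`-minimal elements by
simple reflections that raise the height by one. -/
theorem BoundedBelow.height_induction {cs : CoxeterSystem M W} {σ : W → X → X} {ht : X → ℚ}
    (hact : IsActionOf σ) (hqp : IsQP cs σ ht) (hbb : BoundedBelow cs σ ht) {P : X → Prop}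
    (minimal : ∀ x, WMin cs σ ht x → P x)
    (step : ∀ x i, ht (σ (cs.simple i) x) = ht x + 1 → P x → P (σ (cs.simple i) x)) (x : X) :
    P x := by
  obtain ⟨w, hw⟩ := hbb x
  have key : ∀ (n : ℕ) (u : W), ht (σ u (σ w x)) < ht (σ w x) + n → P (σ u (σ w x)) := by
    intro n
    induction n with
    | zero =>
      intro u hu
      have := hw.height_le hact hqp u
      simp only [Nat.cast_zero, add_zero] at hu
      exact absurd hu this.not_gt
    | succ n ih =>
      intro u hu
      by_cases hmin : WMin cs σ ht (σ u (σ w x))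
      · exact minimal _ hmin
      · simp only [WMin, not_forall, not_le] at hmin
        obtain ⟨i, hi⟩ := hmin
        have hdrop := hqp.1.height_simple_of_lt hi
        have hP := ih (cs.simple i * u) (by
          rw [hact.2, hdrop]
          push_cast at hu
          linarith)
        rw [hact.2] at hP
        have := step _ i (by rw [hact.simple_simple, hdrop]; ring) hP
        rwa [hact.simple_simple] at this
  obtain ⟨n, hn⟩ := exists_nat_gt (ht x - ht (σ w x))
  have hx : σ w⁻¹ (σ w x) = x := by rw [← hact.2, inv_mul_cancel, hact.1]
  have := key n w⁻¹ (by rw [hx]; linarith)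
  rwa [hx] at this

/-- The common form of `Ts` and `Us`: the operator that acts by the scalar `c` on the basis elements
whose height is fixed by `s`. -/
def heckeOp (cs : CoxeterSystem M W) (σ : W → X → X) (ht : X → ℚ) (c : A) (i : B) :
    (X →₀ A) →ₗ[A] (X →₀ A) :=
  Finsupp.lift (X →₀ A) A X fun x =>
    if ht x < ht (σ (cs.simple i) x) then Mstd (σ (cs.simple i) x)
    else if ht (σ (cs.simple i) x) < ht x then Mstd (σ (cs.simple i) x) + (v - vinv) • Mstd x
    else c • Mstd x

/-- The common form of `IsBarOpM` and `IsBarOpN`. -/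
def IsBarOp (cs : CoxeterSystem M W) (σ : W → X → X) (ht : X → ℚ) (c : A)
    (β : (X →₀ A) → (X →₀ A)) : Prop :=
  (∀ m m', β (m + m') = β m + β m') ∧
  (∀ (f : A) (m : X →₀ A), β (f • m) = Abar f • β m) ∧
  (∀ (i : B) (m : X →₀ A),
    β (heckeOp cs σ ht c i m) = heckeOp cs σ ht c i (β m) + (vinv - v) • β m) ∧
  (∀ x : X, WMin cs σ ht x → β (Mstd x) = Mstd x)

theorem heckeOp_Mstd (cs : CoxeterSystem M W) (σ : W → X → X) (ht : X → ℚ) (c : A) (i : B)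
    (x : X) :
    heckeOp cs σ ht c i (Mstd x) =
      if ht x < ht (σ (cs.simple i) x) then Mstd (σ (cs.simple i) x)
      else if ht (σ (cs.simple i) x) < ht x then Mstd (σ (cs.simple i) x) + (v - vinv) • Mstd x
      else c • Mstd x := by
  rw [heckeOp, Mstd, Finsupp.lift_apply, Finsupp.sum_single_index, one_smul]
  · rfl
  · exact zero_smul _ _

/-- The span of the basis elements of height less than `h`. -/
def belowHeight (ht : X → ℚ) (h : ℚ) : Submodule A (X →₀ A) :=
  Finsupp.supported A A {y | ht y < h}

theorem Mstd_mem_belowHeight {ht : X → ℚ} {h : ℚ} {x : X} (hx : ht x < h) :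
    Mstd x ∈ belowHeight ht h :=
  Finsupp.single_mem_supported A 1 hx

theorem belowHeight_mono (ht : X → ℚ) {h h' : ℚ} (hh : h ≤ h') :
    belowHeight ht h ≤ belowHeight ht h' :=
  Finsupp.supported_mono fun _ hy => lt_of_lt_of_le hy hh

theorem heckeOp_mem_belowHeight {cs : CoxeterSystem M W} {σ : W → X → X} {ht : X → ℚ}
    (hsc : IsScaled cs σ ht) (c : A) (i : B) {h : ℚ} {m : X →₀ A} (hm : m ∈ belowHeight ht h) :
    heckeOp cs σ ht c i m ∈ belowHeight ht (h + 1) := by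
  suffices belowHeight ht h ≤ (belowHeight ht (h + 1)).comap (heckeOp cs σ ht c i) from this hm
  rw [belowHeight, Finsupp.supported_eq_span_single, Submodule.span_le]
  rintro _ ⟨x, hx, rfl⟩
  have hx : ht x < h := hx
  have h₁ : (Mstd (σ (cs.simple i) x) : X →₀ A) ∈ belowHeight ht (h + 1) :=
    Mstd_mem_belowHeight (by linarith [hsc.height_simple_le i x])
  have h₂ : (Mstd x : X →₀ A) ∈ belowHeight ht (h + 1) := Mstd_mem_belowHeight (by linarith)
  change heckeOp cs σ ht c i (Mstd x) ∈ belowHeight ht (h + 1)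
  rw [heckeOp_Mstd]
  split_ifs
  · exact h₁
  · exact add_mem h₁ (Submodule.smul_mem _ _ h₂)
  · exact Submodule.smul_mem _ _ h₂

/-- A bar operator is unitriangular with respect to the height. -/
theorem IsBarOp.sub_mem_belowHeight {cs : CoxeterSystem M W} {σ : W → X → X} {ht : X → ℚ}
    (hact : IsActionOf σ) (hqp : IsQP cs σ ht) (hbb : BoundedBelow cs σ ht) {c : A}
    {β : (X →₀ A) → (X →₀ A)} (hβ : IsBarOp cs σ ht c β) (x : X) :
    β (Mstd x) - Mstd x ∈ belowHeight ht (ht x) := by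
  induction x using hbb.height_induction hact hqp with
  | minimal x hx => simp [hβ.2.2.2 x hx]
  | step x i hi ih =>
    have hT : heckeOp cs σ ht c i (Mstd x) = Mstd (σ (cs.simple i) x) := by
      rw [heckeOp_Mstd, if_pos (by linarith)]
    have hβT := hβ.2.2.1 i (Mstd x)
    have hdecomp : β (Mstd (σ (cs.simple i) x)) - Mstd (σ (cs.simple i) x) =
        heckeOp cs σ ht c i (β (Mstd x) - Mstd x) +
          ((vinv - v) • (β (Mstd x) - Mstd x) + (vinv - v) • Mstd x) := by
      rw [hT] at hβT
      rw [hβT, map_sub, hT, smul_sub]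
      abel
    rw [hdecomp, hi]
    refine add_mem (heckeOp_mem_belowHeight hqp.1 c i ih) (add_mem ?_ ?_)
    · exact Submodule.smul_mem _ _ (belowHeight_mono ht (by linarith) ih)
    · exact Submodule.smul_mem _ _ (Mstd_mem_belowHeight (by linarith))

theorem IsBarOp.apply_of_forall_height_le {cs : CoxeterSystem M W} {σ : W → X → X}
    {ht : X → ℚ} (hact : IsActionOf σ) (hqp : IsQP cs σ ht) (hbb : BoundedBelow cs σ ht) {c : A}
    {β : (X →₀ A) → (X →₀ A)} (hβ : IsBarOp cs σ ht c β) {m : X →₀ A} {x : X}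
    (hx : ∀ y ∈ m.support, ht y ≤ ht x) : β m x = Abar (m x) := by
  classical
  have hcoeff : ∀ y, ht y ≤ ht x → β (Mstd y) x = if y = x then 1 else 0 := by
    intro y hy
    have := (Finsupp.mem_supported' A _).1 (hβ.sub_mem_belowHeight hact hqp hbb y) x
      (by simpa using hy)
    rw [Finsupp.sub_apply, sub_eq_zero] at this
    rw [this, Mstd, Finsupp.single_apply]
  have hm : m = ∑ y ∈ m.support, m y • Mstd y := by
    conv_lhs => rw [← Finsupp.sum_single m]
    simp [Finsupp.sum, Mstd]
  have hβm : β m = ∑ y ∈ m.support, Abar (m y) • β (Mstd y) := by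
    conv_lhs => rw [hm]
    change AddMonoidHom.mk' β hβ.1 _ = _
    rw [map_sum]
    exact Finset.sum_congr rfl fun y _ => hβ.2.1 _ _
  rw [hβm, Finsupp.finsetSum_apply,
    Finset.sum_congr rfl fun y hy => by rw [Finsupp.smul_apply, hcoeff y (hx y hy)]]
  simp only [smul_eq_mul, mul_ite, mul_one, mul_zero, Finset.sum_ite_eq', Finsupp.mem_support_iff]
  split_ifs with h
  · rfl
  · rw [not_not.1 h]
    exact (map_zero (LaurentPolynomial.invert (R := ℤ))).symm

theorem IsBarOp.eq_zero_of_invariant {cs : CoxeterSystem M W} {σ : W → X → X} {ht : X → ℚ}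
    (hact : IsActionOf σ) (hqp : IsQP cs σ ht) (hbb : BoundedBelow cs σ ht) {c : A}
    {β : (X →₀ A) → (X →₀ A)} (hβ : IsBarOp cs σ ht c β) {𝒞 : Set A}
    (h𝒞 : ∀ f ∈ 𝒞, Abar f = f → f = 0) {m : X →₀ A} (hm : β m = m) (hcoeff : ∀ x, m x ∈ 𝒞) :
    m = 0 := by
  by_contra hne
  obtain ⟨x, hx, hmax⟩ :=
    Finset.exists_max_image m.support ht (Finsupp.support_nonempty_iff.2 hne)
  have := hβ.apply_of_forall_height_le hact hqp hbb hmax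
  rw [hm] at this
  exact Finsupp.mem_support_iff.1 hx (h𝒞 _ (hcoeff x) this.symm)

theorem coeff_of_mem_negPart {f : A} (hf : f ∈ negPart) {k : ℤ} (hk : 0 ≤ k) :
    f.coeff k = 0 := by
  obtain ⟨p, rfl⟩ := hf
  induction p using Polynomial.induction_on' with
  | add p q hp hq =>
    rw [mul_add, map_add, AddMonoidAlgebra.coeff_add, Finsupp.add_apply, hp, hq, add_zero]
  | monomial n a =>
    have : Polynomial.aeval vinv (Polynomial.X * Polynomial.monomial n a) =
        a • (T (-(n + 1)) : A) := by
      rw [Polynomial.X_mul_monomial, Polynomial.aeval_monomial, vinv, T_pow,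
        Algebra.smul_def]
      congr 2
      push_cast
      ring
    rw [this, AddMonoidAlgebra.coeff_smul, Finsupp.smul_apply, T_apply, if_neg (by omega),
      smul_zero]

theorem eq_zero_of_mem_negPart_of_Abar_eq {f : A} (hf : f ∈ negPart) (hbar : Abar f = f) :
    f = 0 := by
  ext k
  rcases le_total 0 k with hk | hk
  · simpa using coeff_of_mem_negPart hf hk
  · rw [← hbar, Abar, invert_apply]
    simpa using coeff_of_mem_negPart hf (neg_nonneg.2 hk)

/-- Let `X` be quasiparabolic and bounded below with a bar operator `β` on `ℳ`
(resp. `𝒩`), and let `𝒞 ⊆ A` be such that the only bar-invariant element of `𝒞` is `0`.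
If `m` is `β`-invariant and all its coefficients lie in `𝒞`, then `m = 0`.
In particular this applies to `𝒞 = v⁻¹·ℤ[v⁻¹]`. -/
theorem stmt3 (cs : CoxeterSystem M W) (σ : W → X → X) (ht : X → ℚ)
    (hact : IsActionOf σ) (hqp : IsQP cs σ ht) (hbb : BoundedBelow cs σ ht) :
    (∀ 𝒞 : Set A, (∀ f ∈ 𝒞, Abar f = f → f = 0) →
      (∀ β : (X →₀ A) → (X →₀ A), IsBarOpM cs σ ht β →
        ∀ m : X →₀ A, β m = m → (∀ x : X, m x ∈ 𝒞) → m = 0) ∧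
      (∀ β : (X →₀ A) → (X →₀ A), IsBarOpN cs σ ht β →
        ∀ n : X →₀ A, β n = n → (∀ x : X, n x ∈ 𝒞) → n = 0)) ∧
    (∀ f ∈ negPart, Abar f = f → f = 0) := by
  refine ⟨fun 𝒞 h𝒞 => ⟨fun β hβ m hm hcoeff => ?_, fun β hβ n hn hcoeff => ?_⟩,
    fun f hf hbar => eq_zero_of_mem_negPart_of_Abar_eq hf hbar⟩
  · have hβ' : IsBarOp cs σ ht v β := hβ
    exact hβ'.eq_zero_of_invariant hact hqp hbb h𝒞 hm hcoeff
  · have hβ' : IsBarOp cs σ ht (-vinv) β := hβ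
    exact hβ'.eq_zero_of_invariant hact hqp hbb h𝒞 hn hcoeff

end
end

section
/- Let X be a quasiparabolic W-set that is bounded below. If ℳ has a bar operator, then 𝒩 has a bar operator, and conversely: if 𝒩 has a bar operator, then ℳ has a bar operator. -/
noncomputable section

open LaurentPolynomial

variable {B W : Type*} [Group W] {M : CoxeterMatrix B} {X : Type*}

/-- The common form of `Ts` and `Us`: the operator acting by `c` on the basis elements whose
height is unchanged by the `i`-th simple reflection. -/
def scaledOp (c : A) (cs : CoxeterSystem M W) (σ : W → X → X) (ht : X → ℚ) (i : B) :
    (X →₀ A) →ₗ[A] (X →₀ A) :=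
  Finsupp.lift (X →₀ A) A X fun x =>
    if ht x < ht (σ (cs.simple i) x) then Mstd (σ (cs.simple i) x)
    else if ht (σ (cs.simple i) x) < ht x then Mstd (σ (cs.simple i) x) + (v - vinv) • Mstd x
    else c • Mstd x

/-- The common form of `IsBarOpM` and `IsBarOpN`. -/
def IsScaledBarOp (c : A) (cs : CoxeterSystem M W) (σ : W → X → X) (ht : X → ℚ)
    (β : (X →₀ A) → (X →₀ A)) : Prop :=
  (∀ m m', β (m + m') = β m + β m') ∧
  (∀ (f : A) (m : X →₀ A), β (f • m) = Abar f • β m) ∧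
  (∀ (i : B) (m : X →₀ A),
    β (scaledOp c cs σ ht i m) = scaledOp c cs σ ht i (β m) + (vinv - v) • β m) ∧
  (∀ x : X, WMin cs σ ht x → β (Mstd x) = Mstd x)

lemma Abar_zero : Abar 0 = 0 := map_zero LaurentPolynomial.invert

lemma Abar_one : Abar 1 = 1 := map_one LaurentPolynomial.invert

lemma Abar_add (f g : A) : Abar (f + g) = Abar f + Abar g := map_add LaurentPolynomial.invert f g

lemma Abar_neg (f : A) : Abar (-f) = -Abar f := map_neg LaurentPolynomial.invert f

lemma Abar_sub (f g : A) : Abar (f - g) = Abar f - Abar g := map_sub LaurentPolynomial.invert f g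

lemma Abar_mul (f g : A) : Abar (f * g) = Abar f * Abar g := map_mul LaurentPolynomial.invert f g

lemma Abar_Abar (f : A) : Abar (Abar f) = f := LaurentPolynomial.involutive_invert f

lemma Abar_v : Abar v = vinv := LaurentPolynomial.invert_T 1

lemma Abar_vinv : Abar vinv = v := by rw [← Abar_v, Abar_Abar]

/-- The sign `(-1)^⌊h⌋`, as an element of `A`. -/
def heightSign (h : ℚ) : A := ((⌊h⌋.negOnePow : ℤ) : A)

lemma Abar_heightSign (h : ℚ) : Abar (heightSign h) = heightSign h :=
  map_intCast LaurentPolynomial.invert _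

lemma heightSign_mul_self (h : ℚ) : heightSign h * heightSign h = 1 := by
  rw [heightSign, ← Int.cast_mul, ← Units.val_mul, Int.units_mul_self, Units.val_one, Int.cast_one]

lemma heightSign_add_one (h : ℚ) : heightSign (h + 1) = -heightSign h := by
  rw [heightSign, Int.floor_add_one, Int.negOnePow_succ, Units.val_neg, Int.cast_neg, heightSign]

/-- The semilinear involution of the free module sending `M_x` to `(-1)^⌊ht x⌋ M_x`. -/
def signedBar (ht : X → ℚ) (m : X →₀ A) : X →₀ A :=
  Finsupp.onFinset m.support (fun x => heightSign (ht x) * Abar (m x)) fun x hx => by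
    rw [Finsupp.mem_support_iff]
    intro h
    exact hx (by rw [h, Abar_zero, mul_zero])

lemma signedBar_apply (ht : X → ℚ) (m : X →₀ A) (x : X) :
    signedBar ht m x = heightSign (ht x) * Abar (m x) := rfl

lemma signedBar_zero (ht : X → ℚ) : signedBar ht 0 = 0 := by
  ext1 x
  rw [signedBar_apply, Finsupp.zero_apply, Abar_zero, mul_zero]

lemma signedBar_add (ht : X → ℚ) (m n : X →₀ A) :
    signedBar ht (m + n) = signedBar ht m + signedBar ht n := by
  ext1 x
  simp only [signedBar_apply, Finsupp.add_apply, Abar_add, mul_add]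

lemma signedBar_smul (ht : X → ℚ) (f : A) (m : X →₀ A) :
    signedBar ht (f • m) = Abar f • signedBar ht m := by
  ext1 x
  simp only [signedBar_apply, Finsupp.smul_apply, smul_eq_mul, Abar_mul]
  ring

lemma signedBar_signedBar (ht : X → ℚ) (m : X →₀ A) : signedBar ht (signedBar ht m) = m := by
  ext1 x
  rw [signedBar_apply, signedBar_apply, Abar_mul, Abar_Abar, Abar_heightSign, ← mul_assoc,
    heightSign_mul_self, one_mul]

lemma signedBar_neg (ht : X → ℚ) (m : X →₀ A) : signedBar ht (-m) = -signedBar ht m := by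
  ext1 x
  simp only [signedBar_apply, Finsupp.neg_apply, Abar_neg, mul_neg]

lemma signedBar_Mstd (ht : X → ℚ) (x : X) :
    signedBar ht (Mstd x) = heightSign (ht x) • Mstd x := by
  classical
  ext1 y
  rw [signedBar_apply, Finsupp.smul_apply, smul_eq_mul, Mstd, Finsupp.single_apply]
  split_ifs with h
  · rw [h, Abar_one]
  · rw [Abar_zero, mul_zero, mul_zero]

lemma scaledOp_Mstd (c : A) (cs : CoxeterSystem M W) (σ : W → X → X) (ht : X → ℚ) (i : B) (x : X) :
    scaledOp c cs σ ht i (Mstd x) =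
      if ht x < ht (σ (cs.simple i) x) then Mstd (σ (cs.simple i) x)
      else if ht (σ (cs.simple i) x) < ht x then Mstd (σ (cs.simple i) x) + (v - vinv) • Mstd x
      else c • Mstd x := by
  simp only [scaledOp, Mstd, Finsupp.lift_apply, Finsupp.sum_single_index, zero_smul, one_smul]

lemma signedBar_scaledOp_Mstd (c : A) (cs : CoxeterSystem M W) (σ : W → X → X) (ht : X → ℚ)
    (hs : IsScaled cs σ ht) (i : B) (x : X) :
    signedBar ht (scaledOp (-Abar c) cs σ ht i (Mstd x)) =
      -scaledOp c cs σ ht i (signedBar ht (Mstd x)) := by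
  rw [signedBar_Mstd, map_smul, scaledOp_Mstd, scaledOp_Mstd]
  have hx := hs i x
  simp only [Set.mem_insert_iff, Set.mem_singleton_iff] at hx
  split_ifs with h₁ h₂
  · have h : ht (σ (cs.simple i) x) = ht x + 1 := by rcases hx with h | h | h <;> linarith
    rw [signedBar_Mstd, h, heightSign_add_one, neg_smul]
  · have h : ht x = ht (σ (cs.simple i) x) + 1 := by rcases hx with h | h | h <;> linarith
    rw [signedBar_add, signedBar_smul, signedBar_Mstd, signedBar_Mstd, h, heightSign_add_one,
      Abar_sub, Abar_v, Abar_vinv]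
    module
  · rw [signedBar_smul, signedBar_Mstd, Abar_neg, Abar_Abar]
    module

lemma signedBar_scaledOp (c : A) (cs : CoxeterSystem M W) (σ : W → X → X) (ht : X → ℚ)
    (hs : IsScaled cs σ ht) (i : B) (m : X →₀ A) :
    signedBar ht (scaledOp (-Abar c) cs σ ht i m) = -scaledOp c cs σ ht i (signedBar ht m) := by
  induction m using Finsupp.induction_linear with
  | zero => rw [map_zero, signedBar_zero, map_zero, neg_zero]
  | add m n hm hn => rw [map_add, signedBar_add, hm, hn, signedBar_add, map_add, neg_add]
  | single x f =>
    have hf : Finsupp.single x f = f • Mstd x := by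
      rw [Mstd, Finsupp.smul_single, smul_eq_mul, mul_one]
    rw [hf, map_smul, signedBar_smul, signedBar_scaledOp_Mstd c cs σ ht hs, signedBar_smul,
      map_smul, smul_neg]

lemma IsScaledBarOp.conj_signedBar {c : A} {cs : CoxeterSystem M W} {σ : W → X → X} {ht : X → ℚ}
    (hs : IsScaled cs σ ht) {β : (X →₀ A) → (X →₀ A)} (hβ : IsScaledBarOp c cs σ ht β) :
    IsScaledBarOp (-Abar c) cs σ ht fun m => signedBar ht (β (signedBar ht m)) := by
  obtain ⟨hadd, hsmul, hop, hmin⟩ := hβ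
  refine ⟨fun m n => ?_, fun f m => ?_, fun i m => ?_, fun x hx => ?_⟩ <;> dsimp only
  · rw [signedBar_add, hadd, signedBar_add]
  · rw [signedBar_smul, hsmul, signedBar_smul, Abar_Abar]
  · have hneg (n : X →₀ A) : β (-n) = -β n := by
      rw [← neg_one_smul A n, hsmul, Abar_neg, Abar_one, neg_one_smul]
    have hcomm := signedBar_scaledOp c cs σ ht hs i (signedBar ht (β (signedBar ht m)))
    rw [signedBar_signedBar] at hcomm
    rw [signedBar_scaledOp c cs σ ht hs, hneg, hop, neg_add, ← hcomm, signedBar_add,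
      signedBar_signedBar, signedBar_neg, signedBar_smul, Abar_sub, Abar_v, Abar_vinv]
    module
  · rw [signedBar_Mstd, hsmul, hmin x hx, signedBar_smul, signedBar_Mstd, Abar_Abar, smul_smul,
      heightSign_mul_self, one_smul]

/-- Let `X` be a quasiparabolic `W`-set that is bounded below. Then `ℳ` has a
bar operator if and only if `𝒩` has a bar operator. -/
theorem stmt7 (cs : CoxeterSystem M W) (σ : W → X → X) (ht : X → ℚ)
    (hact : IsActionOf σ) (hqp : IsQP cs σ ht) (hbb : BoundedBelow cs σ ht) :
    (∃ β : (X →₀ A) → (X →₀ A), IsBarOpM cs σ ht β) ↔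
    (∃ β : (X →₀ A) → (X →₀ A), IsBarOpN cs σ ht β) := by
  have hs := hqp.1
  constructor
  · rintro ⟨β, hβ⟩
    have h := IsScaledBarOp.conj_signedBar (c := v) hs hβ
    rw [Abar_v] at h
    exact ⟨fun m => signedBar ht (β (signedBar ht m)), h⟩
  · rintro ⟨β, hβ⟩
    have h := IsScaledBarOp.conj_signedBar (c := -vinv) hs hβ
    rw [Abar_neg, Abar_vinv, neg_neg] at h
    exact ⟨fun m => signedBar ht (β (signedBar ht m)), h⟩

end
end
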